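/- There is no twice continuously differentiable function w : ℝ² → ℝ that is positive everywhere, harmonic (i.e., w_xx(x, y) + w_yy(x, y) = 0 for all (x, y) ∈ ℝ²), and such that the function (x, y) ↦ w(x, y) · (1 + x² + y²) is bounded on ℝ². -/

import Mathlib

lemma deriv_deriv_comp_affine {E F : Type*} [NormedAddCommGroup E] [NormedSpace ℝ E]
    [NormedAddCommGroup F] [NormedSpace ℝ F] {f : E → F} (hf : ContDiff ℝ 2 f) (a v : E) (t : ℝ) :
    deriv (deriv fun s : ℝ => f (a + s • v)) t = iteratedFDeriv ℝ 2 f (a + t • v) ![v, v] := by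
  have hline (s : ℝ) : HasDerivAt (fun s : ℝ => a + s • v) v s := by
    simpa using ((hasDerivAt_id s).smul_const v).const_add a
  have hfirst : deriv (fun s : ℝ => f (a + s • v)) = fun s => fderiv ℝ f (a + s • v) v := by
    ext s
    exact ((hf.differentiable (by norm_num) _).hasFDerivAt.comp_hasDerivAt s (hline s)).deriv
  have hf' : Differentiable ℝ (fderiv ℝ f) :=
    (hf.fderiv_right (m := 1) (by norm_num)).differentiable (by norm_num)
  have hsecond : HasDerivAt (fun s : ℝ => fderiv ℝ f (a + s • v))
      (fderiv ℝ (fderiv ℝ f) (a + t • v) v) t :=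
    (hf' (a + t • v)).hasFDerivAt.comp_hasDerivAt t (hline t)
  have happly := (ContinuousLinearMap.apply ℝ F v).hasFDerivAt.comp_hasDerivAt t hsecond
  rw [hfirst, iteratedFDeriv_two_apply]
  exact happly.deriv

open InnerProductSpace in
lemma harmonicOnNhd_univ_of_deriv_deriv_add_eq_zero {w : ℝ → ℝ → ℝ}
    (hw : ContDiff ℝ 2 fun p : ℝ × ℝ => w p.1 p.2)
    (h : ∀ x y : ℝ,
      deriv (deriv fun t => w t y) x + deriv (deriv fun t => w x t) y = 0) :
    HarmonicOnNhd (fun z : ℂ => w z.re z.im) Set.univ := by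
  have hf : ContDiff ℝ 2 fun z : ℂ => w z.re z.im :=
    hw.comp (Complex.reCLM.contDiff.prodMk Complex.imCLM.contDiff)
  refine fun z _ => ⟨hf.contDiffAt, .of_forall fun u => ?_⟩
  have hx := deriv_deriv_comp_affine hf (u.im * Complex.I) 1 u.re
  have hy := deriv_deriv_comp_affine hf u.re Complex.I u.im
  have hu : (u.im * Complex.I + u.re • (1 : ℂ) : ℂ) = u := by
    apply Complex.ext <;> simp
  have hu' : (u.re + u.im • Complex.I : ℂ) = u := by
    apply Complex.ext <;> simp
  rw [hu] at hx
  rw [hu'] at hy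
  simp only [laplacian_eq_iteratedFDeriv_complexPlane, ← hx, ← hy]
  simpa using h u.re u.im


/-- There is no `C²` function `w : ℝ² → ℝ` that is positive everywhere, harmonic
(`w_xx + w_yy = 0` everywhere), and such that `(x,y) ↦ w(x,y)·(1 + x² + y²)` is
bounded on `ℝ²`. -/
theorem stmt_5 :
    ¬ ∃ w : ℝ → ℝ → ℝ,
      ContDiff ℝ 2 (fun p : ℝ × ℝ => w p.1 p.2) ∧
      (∀ x y : ℝ, 0 < w x y) ∧
      (∀ x y : ℝ, deriv (deriv (fun t => w t y)) x + deriv (deriv (fun t => w x t)) y = 0) ∧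
      (∃ M : ℝ, ∀ x y : ℝ, |w x y * (1 + x ^ 2 + y ^ 2)| ≤ M) := by
  rintro ⟨w, hw, hpos, hharm, M, hM⟩
  have hle (x y : ℝ) : w x y * (1 + x ^ 2 + y ^ 2) ≤ M := (le_abs_self _).trans (hM x y)
  have hbound : Bornology.IsBounded (Set.range fun z : ℂ => w z.re z.im) := by
    refine (Metric.isBounded_Icc 0 M).subset ?_
    rintro _ ⟨z, rfl⟩
    refine ⟨(hpos _ _).le, le_trans ?_ (hle z.re z.im)⟩
    exact le_mul_of_one_le_right (hpos _ _).le (by nlinarith [sq_nonneg z.re, sq_nonneg z.im])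
  have hconst (x : ℝ) : w x 0 = w 0 0 := by
    simpa using InnerProductSpace.bounded_harmonic_on_complex_plane_is_constant _
      (harmonicOnNhd_univ_of_deriv_deriv_add_eq_zero hw hharm) hbound x 0
  have hc := hpos 0 0
  have hx := hle (M / w 0 0) 0
  have h0 := hle 0 0
  rw [hconst] at hx
  have hmul : w 0 0 * (M / w 0 0) = M := mul_div_cancel₀ M hc.ne'
  nlinarith [sq_nonneg (M / w 0 0 - 1)]
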